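/- arXiv:2009.13679 — 2 statements merged into one kernel-verified Lean document; each statement's English description precedes it below -/
import Mathlib

section
/- Let k be an algebraically closed field of characteristic p > 0 and let F_1, ..., F_n ∈ k[Y_1, ..., Y_n] be homogeneous polynomials, all of the same degree p^{2e}, satisfying a relation Y_1^{p^e} F_1 + Y_2^{p^e} F_2 + ⋯ + Y_n^{p^e} F_n = 0 with not all F_i zero. Then F_1, ..., F_n is not a regular sequence, the ideal ⟨F_1, ..., F_n⟩ has height strictly less than n, and consequently there exists a nonzero point (y_1, ..., y_n) ∈ k^n with F_1(y) = ⋯ = F_n(y) = 0. -/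
open MvPolynomial

theorem aux_colon {σ k : Type*} [Fintype σ] [DecidableEq σ] [Field k] (Q : ℕ)
    (s : σ → MvPolynomial σ k)
    (h : ∑ i, (X i : MvPolynomial σ k) ^ Q * s i = 0) (i0 : σ) :
    s i0 ∈ Ideal.span ((fun i => (X i : MvPolynomial σ k) ^ Q) '' {i | i ≠ i0}) := by
  have himg : (fun i => (X i : MvPolynomial σ k) ^ Q) '' {i | i ≠ i0}
      = (fun s => monomial s (1 : k)) '' ((fun i => Finsupp.single i Q) '' {i | i ≠ i0}) := by
    rw [Set.image_image]
    simp only [X_pow_eq_monomial]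
  rw [himg, mem_ideal_span_monomial_image]
  intro m hm
  have h2 : (X i0 : MvPolynomial σ k) ^ Q * s i0 ∈
      Ideal.span ((fun i => (X i : MvPolynomial σ k) ^ Q) '' {i | i ≠ i0}) := by
    rw [← Finset.add_sum_erase _ _ (Finset.mem_univ i0)] at h
    rw [eq_neg_of_add_eq_zero_left h]
    refine neg_mem (sum_mem fun i hi => Ideal.mul_mem_right _ _ (Ideal.subset_span ⟨i, ?_, rfl⟩))
    simpa using hi
  rw [himg, mem_ideal_span_monomial_image] at h2
  obtain ⟨t, ⟨i, hi, rfl⟩, hle⟩ := h2 (Finsupp.single i0 Q + m) (by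
    rw [X_pow_eq_monomial, mem_support_iff, coeff_monomial_mul, one_mul]
    exact mem_support_iff.1 hm)
  refine ⟨_, ⟨i, hi, rfl⟩, ?_⟩
  rw [Finsupp.single_le_iff] at hle ⊢
  have hi' : i ≠ i0 := hi
  simpa [Finsupp.single_apply, hi'.symm] using hle

theorem aux_torsion (A M : Type*) [CommRing A] [IsDomain A] [AddCommGroup M] [Module A M]
    [Module.Finite A M] : ∃ (s : Set M) (c : A), c ≠ 0 ∧ LinearIndepOn A id s ∧
      ∀ x : M, c • x ∈ Submodule.span A s := by
  obtain ⟨s, hs, li⟩ := exists_set_linearIndependent A M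
  have h1 := Submodule.rank_quotient_add_rank (Submodule.span A s)
  have h2 : Module.rank A (Submodule.span A s) = Module.rank A M := by
    rw [← hs]; exact rank_span_set li
  have h3 : Module.rank A (M ⧸ Submodule.span A s) = 0 := by
    rw [h2] at h1
    nth_rewrite 2 [← zero_add (Module.rank A M)] at h1
    exact Cardinal.eq_of_add_eq_add_right h1 (Module.rank_lt_aleph0 A M)
  have h4 : Module.IsTorsion A (M ⧸ Submodule.span A s) := Module.rank_eq_zero_iff_isTorsion.1 h3
  obtain ⟨c, hc, hc'⟩ := Submodule.annihilator_top_inter_nonZeroDivisors h4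
  refine ⟨s, c, nonZeroDivisors.ne_zero hc', li, fun x => ?_⟩
  have := Submodule.mem_annihilator.1 hc (Submodule.Quotient.mk x) trivial
  rwa [← Submodule.Quotient.mk_smul, Submodule.Quotient.mk_eq_zero] at this

theorem aux_mem_pow {σ k : Type*} [Field k] {f : MvPolynomial σ k} {d : ℕ} (h : f.IsHomogeneous d)
    {M : ℕ} (hM : M ≤ d) : f ∈ idealOfVars σ k ^ M := by
  rw [mem_pow_idealOfVars_iff']
  intro x hx
  exact h.coeff_eq_zero (by omega)

theorem aux_eq_zero {σ k : Type*} [Field k] {f : MvPolynomial σ k} {D : ℕ}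
    (h : f ∈ idealOfVars σ k ^ D) (h2 : f.totalDegree < D) : f = 0 := by
  rw [mem_pow_idealOfVars_iff'] at h
  ext x
  rw [coeff_zero]
  by_contra hx
  have h3 := le_totalDegree (mem_support_iff.2 hx)
  refine hx (h x ?_)
  exact lt_of_le_of_lt h3 h2

theorem aux_finite {n : ℕ} {k : Type*} [Field k] (d M : ℕ) (hd : 0 < d)
    (F : Fin n → MvPolynomial (Fin n) k) (hdeg : ∀ i, (F i).IsHomogeneous d)
    (hM : idealOfVars (Fin n) k ^ M ≤ Ideal.span (Set.range F)) :
    Module.Finite (Algebra.adjoin k (Set.range F)) (MvPolynomial (Fin n) k) := by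
  set A := Algebra.adjoin k (Set.range F)
  let T : Set (MvPolynomial (Fin n) k) :=
    (fun m : Fin n →₀ ℕ => monomial m (1 : k)) '' {m | m.degree < max M d}
  have hT : T.Finite := by
    apply Set.Finite.image
    exact Finsupp.finite_of_degree_le (max M d) |>.subset (fun m hm => by
      have hm' : m.degree < max M d := by simpa using hm
      exact hm'.le)
  let N := Submodule.span A T
  have key : ∀ D : ℕ, ∀ h : MvPolynomial (Fin n) k, h.IsHomogeneous D → h ∈ N := by
    intro D
    induction D using Nat.strong_induction_on with
    | _ D ih =>
      intro h hh
      rcases lt_or_ge D (max M d) with hD | hD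
      · rw [h.as_sum]
        refine sum_mem fun m hm => ?_
        have : monomial m (coeff m h) = (algebraMap k A (coeff m h)) • monomial m (1 : k) := by
          rw [algebraMap_smul, smul_monomial, smul_eq_mul, mul_one]
        rw [this]
        refine N.smul_mem _ (Submodule.subset_span ⟨m, ?_, rfl⟩)
        have := hh.degree_eq_sum_deg_support hm
        show m.degree < _
        have : m.degree = D := by
          by_contra hne
          exact mem_support_iff.1 hm (hh.coeff_eq_zero hne)
        omega
      · have h1 := hM (aux_mem_pow hh ((le_max_left _ _).trans hD))
        obtain ⟨g, hg⟩ := (Ideal.mem_span_range_iff_exists_fun).1 h1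
        have h2 : h = ∑ i, F i * homogeneousComponent (D - d) (g i) := by
          rw [← homogeneousComponent_eq_self hh, ← hg, map_sum]
          refine Finset.sum_congr rfl fun i _ => ?_
          let _ := MvPolynomial.gradedAlgebra (σ := Fin n) (R := k)
          have := DirectSum.coe_decompose_mul_of_left_mem_of_le (homogeneousSubmodule (Fin n) k)
            (b := g i) (hdeg i) ((le_max_right _ _).trans hD)
          have h3 : ∀ (f : MvPolynomial (Fin n) k) (j : ℕ),
              ((DirectSum.decompose (homogeneousSubmodule (Fin n) k) f j :
                homogeneousSubmodule (Fin n) k j) : MvPolynomial (Fin n) k)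
                = homogeneousComponent j f :=
            fun f j => decomposition.decompose'_apply f j
          rw [h3, h3] at this
          rw [mul_comm]
          exact this
        rw [h2]
        refine sum_mem fun i _ => ?_
        have h3 : F i * homogeneousComponent (D - d) (g i) =
          (⟨F i, Algebra.subset_adjoin ⟨i, rfl⟩⟩ : A) • homogeneousComponent (D - d) (g i) := rfl
        rw [h3]
        refine N.smul_mem _ (ih (D - d) ?_ _ (homogeneousComponent_isHomogeneous _ _))
        have := (le_max_right M d).trans hD
        omega
  refine ⟨⟨hT.toFinset, ?_⟩⟩
  rw [hT.coe_toFinset, eq_top_iff]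
  intro f _
  rw [← sum_homogeneousComponent f]
  exact sum_mem fun i _ => key i _ (homogeneousComponent_isHomogeneous _ _)

theorem aux_zero {k : Type*} [Field k] [IsAlgClosed k] 
    {n : ℕ} (F : Fin n → MvPolynomial (Fin n) k)
    (h : ∀ y : Fin n → k, (∀ i, MvPolynomial.eval y (F i) = 0) → y = 0) :
    ∃ M, idealOfVars (Fin n) k ^ M ≤ Ideal.span (Set.range F) := by
  refine Ideal.exists_pow_le_of_le_radical_of_fg ?_ (idealOfVars_fg _ _)
  rw [← vanishingIdeal_zeroLocus_eq_radical (K := k), Ideal.span_le]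
  rintro _ ⟨i, rfl⟩
  rw [SetLike.mem_coe, mem_vanishingIdeal_iff]
  intro y hy
  have : y = 0 := h y fun j => by
    have := hy (F j) (Ideal.subset_span ⟨j, rfl⟩)
    simpa [aeval_eq_eval] using this
  simp [this]

theorem aux_algInd {n : ℕ} {k : Type*} [Field k]
    (F : Fin n → MvPolynomial (Fin n) k) 
    [Module.Finite (Algebra.adjoin k (Set.range F)) (MvPolynomial (Fin n) k)] :
    AlgebraicIndependent k F := by
  have : Algebra.IsIntegral (Algebra.adjoin k (Set.range F)) (MvPolynomial (Fin n) k) :=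
    inferInstance
  exact (Algebra.IsAlgebraic.isTranscendenceBasis_of_lift_le_trdeg_of_finite k F
    (by simp [MvPolynomial.trdeg_of_isDomain])).1

theorem aux_height {k : Type*} [Field k] {n : ℕ} (d : ℕ) (F : Fin n → MvPolynomial (Fin n) k)
    (hdeg : ∀ i, (F i).IsHomogeneous d) (y : Fin n → k) (hy : y ≠ 0)
    (h : ∀ i, MvPolynomial.eval y (F i) = 0) :
    ∃ P : PrimeSpectrum (MvPolynomial (Fin n) k),
        Ideal.span (Set.range F) ≤ P.asIdeal ∧ Order.height P < (n : ℕ∞) := by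
  let φ : MvPolynomial (Fin n) k →ₐ[k] Polynomial k :=
    aeval (fun i => Polynomial.C (y i) * Polynomial.X)
  let ψ : MvPolynomial (Fin n) k →ₐ[k] k := aeval (fun i => 0)
  have hφψ : ∀ f, (φ f).eval 0 = ψ f := by
    intro f
    have : (Polynomial.aeval (0 : k)).comp φ = ψ := by
      ext i; simp [φ, ψ]
    rw [← this]; simp
  let P : PrimeSpectrum (MvPolynomial (Fin n) k) := ⟨RingHom.ker φ, RingHom.ker_isPrime _⟩
  let m : PrimeSpectrum (MvPolynomial (Fin n) k) := ⟨RingHom.ker ψ, RingHom.ker_isPrime _⟩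
  have hlt : P < m := by
    refine lt_of_le_of_ne ?_ ?_
    · intro f hf
      have hf : φ f = 0 := hf
      show ψ f = 0
      rw [← hφψ, hf]; simp
    · intro he
      apply hy
      ext i
      have : (X i : MvPolynomial (Fin n) k) ∈ m.asIdeal := by
        show ψ (X i) = 0
        simp [ψ]
      rw [← he] at this
      have : φ (X i) = 0 := this
      simpa [φ] using this
  have hm : Order.height m ≤ (n : ℕ∞) := by
    have h1 := Order.height_le_krullDim m
    have h2 : Order.krullDim (PrimeSpectrum (MvPolynomial (Fin n) k)) = n := by
      have := MvPolynomial.ringKrullDim_of_isNoetherianRing (R := k) (ι := Fin n)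
      rw [ringKrullDim_eq_zero_of_field, zero_add, Nat.card_fin] at this
      exact this
    rw [h2] at h1
    exact_mod_cast h1
  refine ⟨P, ?_, ?_⟩
  · rw [Ideal.span_le]
    rintro _ ⟨i, rfl⟩
    show φ (F i) = 0
    have : φ (F i) = Polynomial.C (MvPolynomial.eval y (F i)) * Polynomial.X ^ d := by
      simp only [φ]
      rw [aeval_def, eval₂_eq, MvPolynomial.eval_eq, map_sum, Finset.sum_mul]
      refine Finset.sum_congr rfl fun t ht => ?_
      have htd : ∑ i ∈ t.support, t i = d := (hdeg i).degree_eq_sum_deg_support ht |>.symm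
      simp only [mul_pow, Finset.prod_mul_distrib, Finset.prod_pow_eq_pow_sum, htd]
      simp [mul_assoc]
    rw [this, h]; simp
  · have : Order.height P < ⊤ := (Order.height_mono hlt.le).trans_lt (hm.trans_lt (ENat.natCast_lt_top n))
    exact (Order.height_strictMono hlt this).trans_le hm

theorem stmt13 {k : Type*} [Field k] [IsAlgClosed k] (p : ℕ) [Fact p.Prime] [CharP k p]
    {n : ℕ} (e : ℕ) (he : 0 < e) (F : Fin n → MvPolynomial (Fin n) k)
    (hdeg : ∀ i, (F i).IsHomogeneous (p ^ (2 * e)))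
    (hsyz : ∑ i, (X i : MvPolynomial (Fin n) k) ^ p ^ e * F i = 0)
    (hne : ∃ i, F i ≠ 0) :
    (¬ ∀ i : Fin n, ∀ r : MvPolynomial (Fin n) k,
        F i * r ∈ Ideal.span (F '' {j : Fin n | j < i}) →
        r ∈ Ideal.span (F '' {j : Fin n | j < i})) ∧
    (∃ P : PrimeSpectrum (MvPolynomial (Fin n) k),
        Ideal.span (Set.range F) ≤ P.asIdeal ∧ Order.height P < (n : ℕ∞)) ∧
    (∃ y : Fin n → k, y ≠ 0 ∧ ∀ i, MvPolynomial.eval y (F i) = 0) := by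
  have hp1 : 1 < p := (Fact.out : p.Prime).one_lt
  have hq1 : 1 < p ^ e := Nat.one_lt_pow he.ne' hp1
  have hqq : p ^ (2 * e) = p ^ e * p ^ e := by rw [two_mul, pow_add]
  obtain ⟨i1, hi1⟩ := hne
  obtain ⟨n, rfl⟩ : ∃ m, n = m + 1 := ⟨n - 1, by have := i1.isLt; omega⟩
  have hzero : ∃ y : Fin (n+1) → k, y ≠ 0 ∧ ∀ i, MvPolynomial.eval y (F i) = 0 := by
    by_contra! hcon
    obtain ⟨M, hM⟩ := aux_zero F (fun y hy => by
      by_contra h0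
      obtain ⟨i, hi⟩ := hcon y h0
      exact hi (hy i))
    have hfin := aux_finite (p ^ (2 * e)) M (by positivity) F hdeg hM
    have hind := aux_algInd F
    set A := Algebra.adjoin k (Set.range F) with hA
    obtain ⟨s, c, hc, li, hspan⟩ := aux_torsion A (MvPolynomial (Fin (n+1)) k)
    set D := (c : MvPolynomial (Fin (n+1)) k).totalDegree with hD
    set Q := p ^ (D + 1) with hQ
    have hQD : D < Q := (Nat.lt_succ_self D).trans (Nat.lt_pow_self hp1)
    let G : Fin (n+1) → A := fun i => ⟨F i, Algebra.subset_adjoin ⟨i, rfl⟩⟩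
    have hsyzQ : ∑ i, (G i) ^ Q • ((X i : MvPolynomial (Fin (n+1)) k) ^ (p ^ e * Q)) = 0 := by
      have : (∑ i, (X i : MvPolynomial (Fin (n+1)) k) ^ p ^ e * F i) ^ Q = 0 := by
        rw [hsyz, zero_pow (by positivity)]
      rw [hQ, sum_pow_char_pow] at this
      rw [← this]
      refine Finset.sum_congr rfl fun i _ => ?_
      rw [mul_pow, ← pow_mul, mul_comm (X i ^ _)]
      rfl
    have hrep : ∀ i, ∃ l : s →₀ A, Finsupp.linearCombination A (fun x : s => (x : MvPolynomial (Fin (n+1)) k)) l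
        = c • ((X i : MvPolynomial (Fin (n+1)) k) ^ (p ^ e * Q)) := by
      intro i
      have := hspan ((X i : MvPolynomial (Fin (n+1)) k) ^ (p ^ e * Q))
      rw [← Subtype.range_coe (s := s)] at this
      exact Finsupp.mem_span_range_iff_exists_finsupp.1 this
    choose l hl using hrep
    have hlz : ∑ i, (G i) ^ Q • l i = 0 := by
      have li' : LinearIndependent A (fun x : s => (x : MvPolynomial (Fin (n+1)) k)) := li
      rw [linearIndependent_iff] at li'
      apply li'
      rw [map_sum]
      simp only [map_smul, hl]
      simp only [smul_comm _ c]
      rw [← Finset.smul_sum, hsyzQ, smul_zero]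
    let i0 : Fin (n+1) := 0
    have hmem : ∀ x : s, ((l i0 x : A) : MvPolynomial (Fin (n+1)) k) ∈
        idealOfVars (Fin (n+1)) k ^ (p ^ (2 * e) * Q) := by
      intro x
      let E := hind.aevalEquiv
      have hE : ∀ i, E (X i) = G i := fun i => Subtype.ext (by simp [E, G])
      have h1 : ∑ i, (X i : MvPolynomial (Fin (n+1)) k) ^ Q * E.symm (l i x) = 0 := by
        apply E.injective
        rw [map_sum, map_zero]
        simp only [map_mul, map_pow, hE, AlgEquiv.apply_symm_apply]
        have := DFunLike.congr_fun hlz x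
        simpa [Finsupp.finsetSum_apply] using this
      have h2 := aux_colon Q _ h1 i0
      let f : MvPolynomial (Fin (n+1)) k →+* MvPolynomial (Fin (n+1)) k :=
        (A.val.comp E.toAlgHom).toRingHom
      have h3 : f (E.symm (l i0 x)) = l i0 x := by simp [f]
      rw [← h3]
      have h4 : Ideal.span ((fun i => (X i : MvPolynomial (Fin (n+1)) k) ^ Q) '' {i | i ≠ i0}) ≤
          Ideal.comap f (idealOfVars (Fin (n+1)) k ^ (p ^ (2 * e) * Q)) := by
        rw [Ideal.span_le]
        rintro _ ⟨i, -, rfl⟩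
        rw [SetLike.mem_coe, Ideal.mem_comap]
        have : f (X i ^ Q) = F i ^ Q := by
          rw [map_pow]
          congr 1
          show ((E (X i) : A) : MvPolynomial (Fin (n+1)) k) = _
          rw [hE]
        simp only [this]
        exact aux_mem_pow ((hdeg i).pow Q) le_rfl
      exact h4 h2
    have hprod : (c : MvPolynomial (Fin (n+1)) k) * (X i0) ^ (p ^ e * Q) ∈
        idealOfVars (Fin (n+1)) k ^ (p ^ (2 * e) * Q) := by
      have h5 := hl i0
      rw [Finsupp.linearCombination_apply] at h5
      have h6 : (c : MvPolynomial (Fin (n+1)) k) * (X i0) ^ (p ^ e * Q) =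
        c • ((X i0 : MvPolynomial (Fin (n+1)) k) ^ (p ^ e * Q)) := rfl
      rw [h6, ← h5]
      refine sum_mem fun x _ => ?_
      exact Ideal.mul_mem_right _ _ (hmem x)
    have hz := aux_eq_zero hprod (by
      refine (totalDegree_mul _ _).trans_lt ?_
      rw [totalDegree_X_pow, ← hD, hqq]
      have h7 : p ^ e + 1 ≤ p ^ e * p ^ e := by nlinarith
      have h8 := Nat.mul_le_mul_right Q h7
      rw [add_mul, one_mul] at h8
      omega)
    rcases mul_eq_zero.1 hz with h | h
    · exact hc (Subtype.ext h)
    · exact X_ne_zero i0 (pow_eq_zero_iff (by positivity) |>.1 h)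
  refine ⟨?_, ?_, hzero⟩
  · intro hreg
    have h1 := hreg (Fin.last n) (X (Fin.last n) ^ p ^ e) (by
      rw [← Finset.add_sum_erase _ _ (Finset.mem_univ (Fin.last n))] at hsyz
      rw [mul_comm, eq_neg_of_add_eq_zero_left hsyz]
      refine neg_mem (sum_mem fun i hi => Ideal.mul_mem_left _ _ (Ideal.subset_span ⟨i, ?_, rfl⟩))
      have : i ≠ Fin.last n := by simpa using hi
      exact Fin.lt_last_iff_ne_last.2 this)
    have h2 : Ideal.span (F '' {j | j < Fin.last n}) ≤
        idealOfVars (Fin (n+1)) k ^ (p ^ (2 * e)) := by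
      rw [Ideal.span_le]
      rintro _ ⟨i, -, rfl⟩
      exact aux_mem_pow (hdeg i) le_rfl
    have h3 := aux_eq_zero (h2 h1) (by
      rw [totalDegree_X_pow, hqq]; nlinarith)
    exact X_ne_zero (Fin.last n) (pow_eq_zero_iff (by positivity) |>.1 h3)
  · obtain ⟨y, hy, h⟩ := hzero
    exact aux_height _ F hdeg y hy h
end

section
/- Let k be an algebraically closed field of characteristic p > 0 and q = p^e. Every Frobenius form h of degree q+1 in n variables whose representing n×n matrix has rank n (full rank) is equal, after a linear change of coordinates over k, to the diagonal form x_1^{q+1} + x_2^{q+1} + ⋯ + x_n^{q+1}. -/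
open MvPolynomial

section Lang
variable {k : Type*} [Field k]

/-- The recursive polynomials. -/
noncomputable def Ppol (Q : ℕ) (a : ℕ → k) : ℕ → Polynomial k
  | 0 => Polynomial.C (a 0) * Polynomial.X ^ Q
  | i + 1 => Ppol Q a i ^ Q + Polynomial.C (a (i+1)) * Polynomial.X ^ Q

lemma Ppol_dvd (Q : ℕ) (hQ : 2 ≤ Q) (a : ℕ → k) (i : ℕ) : Polynomial.X ^ 2 ∣ Ppol Q a i := by
  have h : (Polynomial.X : Polynomial k) ^ 2 ∣ Polynomial.X ^ Q := pow_dvd_pow _ hQ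
  induction i with
  | zero => exact h.mul_left _
  | succ i ih =>
    exact dvd_add (ih.trans (dvd_pow_self _ (by omega))) (h.mul_left _)

lemma Ppol_zero (Q : ℕ) (hQ : 2 ≤ Q) (a : ℕ → k) (i : ℕ) (h : Ppol Q a i = 0) :
    ∀ j ≤ i, a j = 0 := by
  induction i with
  | zero =>
    intro j hj
    obtain rfl : j = 0 := by omega
    simpa [Ppol] using h
  | succ i ih =>
    have h0 : a (i+1) = 0 := by
      have hd : (Polynomial.X : Polynomial k) ^ (Q+1) ∣ Ppol Q a i ^ Q := by
        have := pow_dvd_pow_of_dvd (Ppol_dvd Q hQ a i) Q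
        rw [← pow_mul] at this
        exact (pow_dvd_pow _ (by omega)).trans this
      obtain ⟨H, hH⟩ := hd
      have h' := h
      rw [Ppol, hH] at h'
      have := congrArg (fun f => Polynomial.coeff f Q) h'
      simpa [Polynomial.coeff_X_pow_mul'] using this
    have h1 : Ppol Q a i = 0 := by
      rw [Ppol, h0] at h
      simp at h
      exact h.1
    intro j hj
    rcases Nat.lt_or_ge i j with hij | hij
    · obtain rfl : j = i+1 := by omega
      exact h0
    · exact ih h1 j hij

variable [IsAlgClosed k]

lemma exists_root (Q : ℕ) (hQ : 2 ≤ Q) (a : ℕ → k) (i : ℕ) (h : ∃ j ≤ i, a j ≠ 0) :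
    ∃ t : k, t ≠ 0 ∧ (Ppol Q a i).eval t = t := by
  have hP : Ppol Q a i ≠ 0 := fun h0 => by
    obtain ⟨j, hj, hj'⟩ := h
    exact hj' (Ppol_zero Q hQ a i h0 j hj)
  obtain ⟨H, hH⟩ := Ppol_dvd Q hQ a i
  have hH0 : H ≠ 0 := by rintro rfl; simp at hH; exact hP hH
  have hdeg : (Polynomial.X * H - Polynomial.C 1).degree ≠ 0 := by
    rw [Polynomial.degree_sub_C]
    · rw [mul_comm, Polynomial.degree_mul_X, Polynomial.degree_eq_natDegree hH0]
      norm_cast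
    · rw [mul_comm, Polynomial.degree_mul_X, Polynomial.degree_eq_natDegree hH0]
      norm_cast; omega
  obtain ⟨t, ht⟩ := IsAlgClosed.exists_root _ hdeg
  have ht' : t * H.eval t = 1 := by
    simpa [Polynomial.IsRoot, sub_eq_zero] using ht
  refine ⟨t, ?_, ?_⟩
  · rintro rfl; simp at ht'
  · rw [hH]; simp; linear_combination t * ht'

/-- Artin--Schreier type equation. -/
lemma exists_as (Q : ℕ) (hQ : 2 ≤ Q) (b c : k)  : ∃ t : k, t ^ Q + b * t = c := by
  have hdeg : (Polynomial.X ^ Q + Polynomial.C b * Polynomial.X - Polynomial.C c).natDegree = Q := by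
    have : (Polynomial.C b * Polynomial.X - Polynomial.C c).natDegree < (Polynomial.X ^ Q : Polynomial k).natDegree := by
      rw [Polynomial.natDegree_X_pow]
      refine lt_of_le_of_lt ?_ hQ
      compute_degree
    rw [add_sub_assoc, Polynomial.natDegree_add_eq_left_of_natDegree_lt this, Polynomial.natDegree_X_pow]
  obtain ⟨t, ht⟩ := IsAlgClosed.exists_root
    (Polynomial.X ^ Q + Polynomial.C b * Polynomial.X - Polynomial.C c) (fun h => by
      rw [Polynomial.natDegree_eq_of_degree_eq_some (n := 0) (by simpa using h)] at hdeg; omega)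
  exact ⟨t, by simpa [Polynomial.IsRoot, sub_eq_zero] using ht⟩

variable (p : ℕ) [Fact p.Prime] [CharP k p] {V : Type*} [AddCommGroup V] [Module k V]
  [FiniteDimensional k V]

theorem lang (m : ℕ) (hm : 0 < m) (φ : V →ₛₗ[iterateFrobenius k p m] V)
    (hφ : Function.Injective φ) : Submodule.span k {v | φ v = v} = ⊤ := by
  have hQ : 2 ≤ p ^ m := (Fact.out : p.Prime).two_le.trans (Nat.le_self_pow hm.ne' p)
  set W := Submodule.span k {v | φ v = v} with hW
  have hsol : ∀ d ∈ W, ∃ w ∈ W, φ w - w = d := by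
    intro d hd
    induction hd using Submodule.closure_induction with
    | zero => exact ⟨0, W.zero_mem, by simp⟩
    | add x y _ _ hx hy =>
      obtain ⟨w, hw, rfl⟩ := hx
      obtain ⟨w', hw', rfl⟩ := hy
      exact ⟨w + w', W.add_mem hw hw', by rw [map_add]; abel⟩
    | smul_mem c x hx =>
      obtain ⟨t, ht⟩ := exists_as (p^m) hQ (-1) c
      refine ⟨t • x, W.smul_mem _ (Submodule.subset_span hx), ?_⟩
      rw [LinearMap.map_smulₛₗ, hx, iterateFrobenius_def, ← sub_smul, ← ht]
      congr 1; ring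
  have hsurj : ∀ d ∈ W, ∃ w ∈ W, φ w = d := by
    intro d hd
    induction hd using Submodule.closure_induction with
    | zero => exact ⟨0, W.zero_mem, by simp⟩
    | add x y _ _ hx hy =>
      obtain ⟨w, hw, rfl⟩ := hx
      obtain ⟨w', hw', rfl⟩ := hy
      exact ⟨w + w', W.add_mem hw hw', by rw [map_add]⟩
    | smul_mem c x hx =>
      obtain ⟨t, ht⟩ := exists_as (p^m) hQ 0 c
      refine ⟨t • x, W.smul_mem _ (Submodule.subset_span hx), ?_⟩
      rw [LinearMap.map_smulₛₗ, hx, iterateFrobenius_def, ← ht]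
      congr 1; ring
  have hback : ∀ r x, φ^[r] x ∈ W → x ∈ W := by
    intro r
    induction r with
    | zero => intro x h; simpa using h
    | succ r ih =>
      intro x h
      rw [Function.iterate_succ_apply] at h
      obtain ⟨w, hw, h'⟩ := hsurj _ (ih _ h)
      rwa [← hφ h']
  by_contra hne
  obtain ⟨u, hu⟩ : ∃ u, u ∉ W := by
    by_contra! h
    exact hne (eq_top_iff.2 fun x _ => h x)
  let M : ℕ → Submodule k V := fun r => Nat.rec W (fun r N => N ⊔ Submodule.span k {φ^[r] u}) r
  have hM0 : M 0 = W := rfl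
  have hMs : ∀ r, M (r+1) = M r ⊔ Submodule.span k {φ^[r] u} := fun r => rfl
  have hmem : ∀ r x, x ∈ M r ↔ ∃ w ∈ W, ∃ a : ℕ → k, x = w + ∑ i ∈ Finset.range r, a i • φ^[i] u := by
    intro r
    induction r with
    | zero => intro x; simp [hM0]
    | succ r ih =>
      intro x
      rw [hMs, Submodule.mem_sup]
      constructor
      · rintro ⟨y, hy, z, hz, rfl⟩
        obtain ⟨w, hw, a, rfl⟩ := (ih y).1 hy
        obtain ⟨c, rfl⟩ := Submodule.mem_span_singleton.1 hz
        refine ⟨w, hw, Function.update a r c, ?_⟩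
        rw [Finset.sum_range_succ, add_assoc]
        congr 2
        · refine Finset.sum_congr rfl fun i hi => ?_
          rw [Function.update_of_ne (by simp at hi; omega)]
        · simp
      · rintro ⟨w, hw, a, rfl⟩
        refine ⟨_, (ih _).2 ⟨w, hw, a, rfl⟩, a r • φ^[r] u,
          Submodule.smul_mem _ _ (Submodule.mem_span_singleton_self _), ?_⟩
        rw [Finset.sum_range_succ, add_assoc]
  have hex : ∃ r, φ^[r] u ∈ M r := by
    obtain ⟨r, hr⟩ := monotone_stabilizes_iff_noetherian.2 (inferInstance : IsNoetherian k V)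
      ⟨M, monotone_nat_of_le_succ fun r => by rw [hMs]; exact le_sup_left⟩
    refine ⟨r, ?_⟩
    have := hr (r+1) (by omega)
    change M r = M (r+1) at this
    rw [this, hMs]
    exact Submodule.mem_sup_right (Submodule.mem_span_singleton_self _)
  classical
  have hr := Nat.find_spec hex
  have hmin : ∀ j < Nat.find hex, φ^[j] u ∉ M j := fun j hj => Nat.find_min hex hj
  generalize Nat.find hex = r at hr hmin
  cases r with
  | zero => exact hu hr
  | succ r =>
    obtain ⟨w, hw, a, ha⟩ := (hmem (r+1) _).1 hr
    have hne : ∃ j ≤ r, a j ≠ 0 := by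
      by_contra! h
      rw [Finset.sum_eq_zero, add_zero] at ha
      · exact hu (hback (r+1) u (ha ▸ hw))
      · intro i hi
        rw [h i (by simp at hi; omega), zero_smul]
    obtain ⟨t, ht0, ht⟩ := exists_root (p^m) hQ a r hne
    let c : ℕ → k := fun i => (Ppol (p^m) a i).eval t
    have hc0 : c 0 = a 0 * t ^ p^m := by simp [c, Ppol]
    have hcs : ∀ i, c (i+1) = c i ^ p^m + a (i+1) * t^p^m := by intro i; simp [c, Ppol]
    have hcr : c r = t := ht
    set x := ∑ i ∈ Finset.range (r+1), c i • φ^[i] u with hx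
    have hφx : φ x = x + t^p^m • w := by
      have e1 : φ x = ∑ i ∈ Finset.range (r+1), c i ^ p^m • φ^[i+1] u := by
        rw [hx, map_sum]
        refine Finset.sum_congr rfl fun i _ => ?_
        rw [LinearMap.map_smulₛₗ, iterateFrobenius_def, Function.iterate_succ_apply']
      have e2 : x = ∑ i ∈ Finset.range r, c i ^ p^m • φ^[i+1] u
          + t^p^m • ∑ i ∈ Finset.range (r+1), a i • φ^[i] u := by
        rw [hx, Finset.sum_range_succ', Finset.sum_range_succ' (fun i => a i • φ^[i] u), hc0,
          smul_add, Finset.smul_sum, ← add_assoc, ← Finset.sum_add_distrib]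
        congr 1
        · refine Finset.sum_congr rfl fun i _ => ?_
          rw [hcs, add_smul, smul_smul]; congr 2; ring
        · rw [smul_smul]; congr 1; ring
      rw [e1, Finset.sum_range_succ, hcr, ha, smul_add]
      rw [e2]
      abel
    obtain ⟨w', hw', hw''⟩ := hsol (-(t^p^m • w)) (W.neg_mem (W.smul_mem _ hw))
    have hfix : x + w' ∈ W := Submodule.subset_span (by
      show φ (x + w') = x + w'
      rw [map_add, hφx, eq_add_of_sub_eq hw'']; abel)
    have hxW : x ∈ W := by simpa using W.sub_mem hfix hw'
    apply hmin r (by omega)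
    rw [hmem]
    refine ⟨t⁻¹ • x, W.smul_mem _ hxW, fun i => - (t⁻¹ * c i), ?_⟩
    rw [hx, Finset.sum_range_succ, hcr, smul_add, smul_smul, inv_mul_cancel₀ ht0, one_smul,
      Finset.smul_sum, add_right_comm, ← Finset.sum_add_distrib, Finset.sum_eq_zero, zero_add]
    intro i _
    rw [smul_smul, ← add_smul, add_neg_cancel, zero_smul]

theorem exists_orthonormal (e : ℕ) (he : 0 < e)
    (B : V →ₛₗ[iterateFrobenius k p e] V →ₗ[k] k)
    (hl : ∀ x, (∀ y, B x y = 0) → x = 0)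
    (φ : V →ₛₗ[iterateFrobenius k p (2 * e)] V)
    (hφ : ∀ x v, B x (φ v) = (B v x) ^ p ^ e)
    (hr : ∀ y, (∀ x, B x y = 0) → y = 0) (m : ℕ) (hm : m ≤ Module.finrank k V) :
    ∃ v : Fin m → V, (∀ i, φ (v i) = v i) ∧ ∀ i j, B (v i) (v j) = if i = j then 1 else 0 := by
  have hQ : 2 ≤ p ^ e := (Fact.out : p.Prime).two_le.trans (Nat.le_self_pow he.ne' p)
  have hspan := lang p (2 * e) (by omega) φ (by
    rw [injective_iff_map_eq_zero]
    intro v hv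
    refine hl v fun x => ?_
    have := hφ x v
    rw [hv, map_zero] at this
    exact eq_zero_of_pow_eq_zero this.symm)
  have hpp : ∀ c : k, c ^ p ^ (2 * e) = (c ^ p ^ e) ^ p ^ e := by
    intro c; rw [← pow_mul, ← pow_add, two_mul]
  have hsm : ∀ (c : k) (x : V), φ (c • x) = ((c ^ p ^ e) ^ p ^ e) • φ x := by
    intro c x; rw [LinearMap.map_smulₛₗ, iterateFrobenius_def, hpp]
  have hsmB : ∀ (c : k) (x y : V), B (c • x) y = c ^ p ^ e * B x y := by
    intro c x y
    rw [LinearMap.map_smulₛₗ, iterateFrobenius_def, LinearMap.smul_apply, smul_eq_mul]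
  have hherm : ∀ x v, φ v = v → B x v = B v x ^ p ^ e := by
    intro x v hv; rw [← hφ, hv]
  have hval : ∀ x v, φ x = x → φ v = v → (B x v ^ p ^ e) ^ p ^ e = B x v := by
    intro x v hx hv; rw [← hherm v x hx, ← hherm x v hv]
  induction m with
  | zero => exact ⟨Fin.elim0, fun i => i.elim0, fun i => i.elim0⟩
  | succ m ih =>
    obtain ⟨v, hv, hvv⟩ := ih (by omega)
    suffices h : ∃ u, φ u = u ∧ (∀ i, B (v i) u = 0) ∧ B u u ≠ 0 by
      obtain ⟨u, hu, hui, huu⟩ := h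
      obtain ⟨c, hc⟩ := exists_as (p ^ e + 1) (by omega) 0 (B u u)⁻¹
      rw [zero_mul, add_zero] at hc
      have hc0 : c ≠ 0 := by
        rintro rfl
        rw [zero_pow (by omega)] at hc
        exact inv_ne_zero huu hc.symm
      have hbq : B u u ^ p ^ e = B u u := (hherm u u hu).symm
      have hcc : (c ^ p ^ e) ^ p ^ e = c := by
        have h1 : (c ^ (p ^ e + 1)) ^ p ^ e = c ^ (p ^ e + 1) := by
          rw [hc, inv_pow, hbq]
        rw [pow_succ, mul_pow] at h1
        have h2 : c ^ p ^ e ≠ 0 := pow_ne_zero _ hc0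
        apply mul_right_cancel₀ h2
        rw [h1]; ring
      have hfix : φ (c • u) = c • u := by rw [hsm, hu, hcc]
      refine ⟨Fin.snoc v (c • u), ?_, ?_⟩
      · intro i
        refine Fin.lastCases ?_ (fun i => ?_) i
        · simpa using hfix
        · simpa using hv i
      · have hz : ∀ i, B (v i) (c • u) = 0 := fun i => by rw [map_smul, hui, smul_zero]
        have hz' : ∀ i, B (c • u) (v i) = 0 := fun i => by
          rw [hherm _ _ (hv i), hz, zero_pow (by omega)]
        intro i j
        refine Fin.lastCases ?_ (fun i => ?_) i <;> refine Fin.lastCases ?_ (fun j => ?_) j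
        · simp only [Fin.snoc_last, if_true]
          rw [hsmB, map_smul, smul_eq_mul, ← mul_assoc, ← pow_succ, hc, inv_mul_cancel₀ huu]
        · simp only [Fin.snoc_last, Fin.snoc_castSucc]
          rw [hz', if_neg (Fin.castSucc_lt_last j).ne']
        · simp only [Fin.snoc_last, Fin.snoc_castSucc]
          rw [hz, if_neg (Fin.castSucc_lt_last i).ne]
        · simp only [Fin.snoc_castSucc, Fin.castSucc_inj]
          exact hvv i j
    by_contra! hno
    -- polarization
    have hpol : ∀ u u', φ u = u → φ u' = u' → (∀ i, B (v i) u = 0) → (∀ i, B (v i) u' = 0) →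
        B u u' = 0 := by
      intro u u' hu hu' hui hui'
      by_contra hb
      obtain ⟨s, hs⟩ := exists_as (p ^ e) hQ (1 : k) 1
      have hs1 : s ^ p ^ e = 1 - s := by linear_combination hs
      have hs2 : (s ^ p ^ e) ^ p ^ e = s := by
        rw [hs1, sub_pow_char_pow, one_pow, hs1]; ring
      set c := s * (B u u')⁻¹ with hc
      have hcc : (c ^ p ^ e) ^ p ^ e = c := by
        rw [hc, mul_pow, mul_pow, hs2, inv_pow, inv_pow, hval u u' hu hu']
      have hcb : c * B u u' = s := by rw [hc, mul_assoc, inv_mul_cancel₀ hb, mul_one]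
      have h1 : φ (c • u') = c • u' := by rw [hsm, hcc, hu']
      have h2 := hno (u + c • u') (by rw [map_add, hu, h1]) (fun i => by
        rw [map_add, hui, map_smul, hui', smul_zero, add_zero])
      have e1 : B u (c • u') = s := by rw [map_smul, smul_eq_mul, hcb]
      have e2 : B (c • u') u = 1 - s := by rw [hherm _ u hu, e1, hs1]
      have e3 : B (c • u') (c • u') = 0 := hno _ h1 (fun i => by
        rw [map_smul, hui', smul_zero])
      rw [map_add, map_add, LinearMap.add_apply, LinearMap.add_apply, hno u hu hui, e1, e2, e3] at h2
      simp at h2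
    have hproj : ∀ x, φ x = x → φ (x - ∑ i, B (v i) x • v i) = x - ∑ i, B (v i) x • v i ∧
        ∀ j, B (v j) (x - ∑ i, B (v i) x • v i) = 0 := by
      intro x hx
      constructor
      · rw [map_sub, map_sum, hx]
        congr 1
        refine Finset.sum_congr rfl fun i _ => ?_
        rw [hsm, hv, hval _ _ (hv i) hx]
      · intro j
        rw [map_sub, map_sum]
        simp [hvv]
    have hzero : ∀ u, φ u = u → (∀ i, B (v i) u = 0) → u = 0 := by
      intro u hu hui
      apply hl
      have hui' : ∀ i, B u (v i) = 0 := fun i => by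
        rw [hherm _ _ (hv i), hui, zero_pow (by omega)]
      have : Submodule.span k {v | φ v = v} ≤ LinearMap.ker (B u) := by
        rw [Submodule.span_le]
        intro x hx
        have h1 := hpol u _ hu (hproj x hx).1 hui (hproj x hx).2
        rw [map_sub, map_sum] at h1
        simpa [hui'] using h1
      intro y
      exact this (hspan ▸ Submodule.mem_top)
    have htop : Submodule.span k (Set.range v) = ⊤ := by
      rw [eq_top_iff, ← hspan, Submodule.span_le]
      intro x hx
      have h1 := hzero _ (hproj x hx).1 (hproj x hx).2
      rw [sub_eq_zero] at h1
      rw [h1]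
      exact Submodule.sum_mem _ fun i _ =>
        Submodule.smul_mem _ _ (Submodule.subset_span ⟨i, rfl⟩)
    have h1 := finrank_range_le_card (R := k) v
    rw [Set.finrank, htop, finrank_top, Fintype.card_fin] at h1
    omega
end Lang

section Mat
open Matrix
variable {k : Type*} [Field k] [IsAlgClosed k] (p : ℕ) [Fact p.Prime] [CharP k p] {n : ℕ}

theorem exists_mat (e : ℕ) (he : 0 < e) (A : Matrix (Fin n) (Fin n) k) (hA : IsUnit A.det) :
    ∃ g : Matrix (Fin n) (Fin n) k, (g.map (· ^ p ^ e))ᵀ * A * g = 1 := by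
  let F : ℕ → (Fin n → k) → (Fin n → k) := fun m x i => x i ^ p ^ m
  have Fadd : ∀ m x y, F m (x + y) = F m x + F m y := fun m x y => by
    ext i; simp [F, add_pow_char_pow]
  have Fsmul : ∀ m (c : k) x, F m (c • x) = c ^ p ^ m • F m x := fun m c x => by
    ext i; simp [F, mul_pow]
  let B : (Fin n → k) →ₛₗ[iterateFrobenius k p e] (Fin n → k) →ₗ[k] k :=
    LinearMap.mk₂'ₛₗ _ _ (fun x y => F e x ⬝ᵥ A *ᵥ y)
      (fun x y z => by rw [Fadd, add_dotProduct])
      (fun c x y => by rw [Fsmul, smul_dotProduct, iterateFrobenius_def])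
      (fun x y z => by rw [mulVec_add, dotProduct_add])
      (fun c x y => by rw [mulVec_smul, dotProduct_smul, RingHom.id_apply])
  have hB : ∀ x y, B x y = F e x ⬝ᵥ A *ᵥ y := fun _ _ => rfl
  let φ : (Fin n → k) →ₛₗ[iterateFrobenius k p (2 * e)] (Fin n → k) :=
    { toFun := fun v => A⁻¹ *ᵥ F e (F e v ᵥ* A)
      map_add' := fun x y => by rw [Fadd, add_vecMul, Fadd, mulVec_add]
      map_smul' := fun c x => by
        rw [Fsmul, smul_vecMul, Fsmul, mulVec_smul, iterateFrobenius_def, ← pow_mul, ← pow_add,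
          two_mul] }
  have hφ : ∀ x v, B x (φ v) = (B v x) ^ p ^ e := by
    intro x v
    have : A *ᵥ φ v = F e (F e v ᵥ* A) := by
      change A *ᵥ (A⁻¹ *ᵥ F e (F e v ᵥ* A)) = _
      rw [mulVec_mulVec, mul_nonsing_inv _ hA, one_mulVec]
    rw [hB, this, hB, dotProduct_mulVec, dotProduct_comm]
    simp only [dotProduct, F]
    rw [sum_pow_char_pow]
    simp [mul_pow]
  have hr : ∀ y, (∀ x, B x y = 0) → y = 0 := by
    intro y h
    have h1 : A *ᵥ y = 0 := by
      ext i
      have := h (Pi.single i 1)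
      have h2 : F e (Pi.single i 1) = Pi.single i 1 := by
        ext j
        by_cases hj : j = i
        · subst hj; simp [F]
        · simp [F, hj, (Fact.out : p.Prime).ne_zero]
      rw [hB, h2] at this
      simpa using this
    have h2 : A⁻¹ *ᵥ (A *ᵥ y) = 0 := by rw [h1, mulVec_zero]
    rwa [mulVec_mulVec, nonsing_inv_mul _ hA, one_mulVec] at h2
  have hl : ∀ x, (∀ y, B x y = 0) → x = 0 := by
    intro x h
    have h1 : F e x = 0 := by
      ext i
      have := h (A⁻¹ *ᵥ Pi.single i 1)
      rw [hB, mulVec_mulVec, mul_nonsing_inv _ hA, one_mulVec] at this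
      simpa using this
    ext i
    exact eq_zero_of_pow_eq_zero (congrFun h1 i)
  obtain ⟨v, -, hv⟩ := exists_orthonormal p e he B hl φ hφ hr n (by simp)
  refine ⟨Matrix.of fun i j => v j i, ?_⟩
  ext i j
  rw [Matrix.one_apply, ← hv i j, hB, Matrix.mul_assoc]
  rfl
end Mat

theorem stmt14 {k : Type*} [Field k] [IsAlgClosed k] (p : ℕ) [Fact p.Prime] [CharP k p]
    {n : ℕ} (e : ℕ) (he : 0 < e) (A : Matrix (Fin n) (Fin n) k) (hA : IsUnit A.det) :
    ∃ g : Matrix (Fin n) (Fin n) k, IsUnit g.det ∧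
      MvPolynomial.aeval (fun i : Fin n => ∑ j, MvPolynomial.C (g i j) * X j)
          (∑ i, ∑ j, MvPolynomial.C (A i j) * (X i ^ p ^ e * X j))
        = ∑ i : Fin n, (X i : MvPolynomial (Fin n) k) ^ (p ^ e + 1) := by
  obtain ⟨g, hg⟩ := exists_mat p e he A hA
  refine ⟨g, ?_, ?_⟩
  · have := congrArg Matrix.det hg
    rw [Matrix.det_mul, Matrix.det_one] at this
    exact IsUnit.of_mul_eq_one_right _ this
  · have key : ∀ a b, ∑ i, ∑ j, A i j * (g i a ^ p ^ e * g j b) = if a = b then 1 else 0 := by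
      intro a b
      rw [← Matrix.one_apply, ← hg, Matrix.mul_assoc]
      simp only [Matrix.mul_apply, Matrix.transpose_apply, Matrix.map_apply, Finset.mul_sum]
      refine Finset.sum_congr rfl fun i _ => Finset.sum_congr rfl fun j _ => ?_
      ring
    have step : ∀ i j, (MvPolynomial.C (A i j) : MvPolynomial (Fin n) k) *
        ((∑ l, MvPolynomial.C (g i l) * X l) ^ p ^ e * ∑ l, MvPolynomial.C (g j l) * X l)
        = ∑ a, ∑ b, MvPolynomial.C (A i j * (g i a ^ p ^ e * g j b)) * (X a ^ p ^ e * X b) := by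
      intro i j
      rw [sum_pow_char_pow, Finset.sum_mul_sum, Finset.mul_sum]
      refine Finset.sum_congr rfl fun a _ => ?_
      rw [Finset.mul_sum]
      refine Finset.sum_congr rfl fun b _ => ?_
      simp only [map_mul, map_pow]
      ring
    simp only [map_sum, map_mul, map_pow, aeval_X, algHom_C, algebraMap_eq, step]
    have swap : ∀ f : Fin n → Fin n → Fin n → Fin n → MvPolynomial (Fin n) k,
        ∑ i, ∑ j, ∑ a, ∑ b, f i j a b = ∑ a, ∑ b, ∑ i, ∑ j, f i j a b := by
      intro f
      calc _ = ∑ i, ∑ a, ∑ j, ∑ b, f i j a b :=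
            Finset.sum_congr rfl fun i _ => Finset.sum_comm
        _ = ∑ a, ∑ i, ∑ b, ∑ j, f i j a b := by
            rw [Finset.sum_comm]
            exact Finset.sum_congr rfl fun a _ => Finset.sum_congr rfl fun i _ => Finset.sum_comm
        _ = _ := Finset.sum_congr rfl fun a _ => Finset.sum_comm
    rw [swap]
    have key2 : ∀ a b, ∑ i, ∑ j, (MvPolynomial.C (A i j * (g i a ^ p ^ e * g j b)) *
        (X a ^ p ^ e * X b) : MvPolynomial (Fin n) k) =
        if a = b then X a ^ p ^ e * X b else 0 := by
      intro a b
      simp only [← Finset.sum_mul, ← map_sum]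
      rw [key]
      split_ifs <;> simp
    simp only [map_mul, map_pow] at key2
    simp [key2, pow_succ]
end
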